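/- Let 𝒯 be a finite undirected tree, w : V(𝒯) → ℝ≥0 a weight function, m = w(𝒯), and let α ∈ [1/3, 1/2]. Then cent^α(𝒯,w) ≤ (1/(2−3α))·OPT(𝒯,w) − ((3α−1)/(2−3α))·m. In particular, for α ≤ 1/3, an α-centroid tree, if it exists, is an optimal search tree. -/

import Mathlib

open Filter Topology

universe u

variable {V : Type u}

/-- Rooted trees with vertices labelled by elements of `V`. -/
inductive RTree (V : Type u) : Type u where
  | node : V → List (RTree V) → RTree V

namespace RTree

/-- The root of a rooted tree. -/
def root : RTree V → V
  | node r _ => r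

/-- The subtrees rooted at the children of the root. -/
def children : RTree V → List (RTree V)
  | node _ ts => ts

/-- The list of pairs `(v, path from the root to v)` over all vertices `v` of the tree. -/
def pathsFrom : RTree V → List (V × List V)
  | node r ts =>
      (r, [r]) ::
        (ts.attach.map fun t => (t.1.pathsFrom.map fun p => (p.1, r :: p.2))).flatten
  decreasing_by
    simp only [RTree.node.sizeOf_spec]
    have := List.sizeOf_lt_of_mem t.2
    omega

/-- The vertex set of a rooted tree. -/
def vertSet (T : RTree V) : Set V := {v | ∃ p ∈ T.pathsFrom, p.1 = v}

/-- `Path_T(v)`: the set of vertices on the path in `T` from the root to `v`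
(including both endpoints). -/
def pathSet (T : RTree V) (v : V) : Set V := {x | ∃ p ∈ T.pathsFrom, p.1 = v ∧ x ∈ p.2}

/-- The depth of a vertex `v` in `T`; the root has depth 1. -/
noncomputable def depth (T : RTree V) (v : V) : ℕ := (T.pathSet v).ncard

/-- All subtrees of a rooted tree (including the tree itself). -/
def allSubtrees : RTree V → List (RTree V)
  | node r ts => node r ts :: (ts.attach.map fun t => t.1.allSubtrees).flatten
  decreasing_by
    simp only [RTree.node.sizeOf_spec]
    have := List.sizeOf_lt_of_mem t.2
    omega

/-- Two rooted trees are equivalent (represent the same search tree) if they have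
the same root-to-vertex paths. -/
def Equiv (T₁ T₂ : RTree V) : Prop := ∀ v, T₁.pathSet v = T₂.pathSet v

end RTree

/-- `x` and `y` are joined by a walk of `G` staying inside `s`. -/
def ReachIn (G : SimpleGraph V) (s : Set V) (x y : V) : Prop :=
  ∃ p : G.Walk x y, ∀ v ∈ p.support, v ∈ s

/-- The connected component of `x` in the subgraph of `G` induced by `s`. -/
def compIn (G : SimpleGraph V) (s : Set V) (x : V) : Set V := {y | ReachIn G s x y}

/-- The set of connected components of the subgraph of `G` induced by `s`. -/
def comps (G : SimpleGraph V) (s : Set V) : Set (Set V) := {c | ∃ x ∈ s, c = compIn G s x}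

/-- `s` induces a (nonempty) connected subgraph of `G`. -/
def ConnIn (G : SimpleGraph V) (s : Set V) : Prop :=
  s.Nonempty ∧ ∀ x ∈ s, ∀ y ∈ s, ReachIn G s x y

/-- The total weight of a set of vertices. -/
noncomputable def wsum (w : V → ℝ) (s : Set V) : ℝ := ∑ᶠ x ∈ s, w x

/-- `IsSearchTree G s T`: `T` is a search tree on the subgraph of `G` induced by `s`.
Its root `r` is a vertex of `s`, its vertex set is `s`, and the subtrees rooted at the
children of `r` are search trees on the connected components of the induced subgraph
on `s \ {r}` (one subtree for each component). -/
inductive IsSearchTree (G : SimpleGraph V) : Set V → RTree V → Prop where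
  | node {s : Set V} {r : V} {ts : List (RTree V)} :
      r ∈ s →
      (RTree.node r ts).vertSet = s →
      (∀ t ∈ ts, IsSearchTree G (compIn G (s \ {r}) t.root) t) →
      ts.Pairwise (fun t₁ t₂ => compIn G (s \ {r}) t₁.root ≠ compIn G (s \ {r}) t₂.root) →
      IsSearchTree G s (RTree.node r ts)

/-- The cost of a search tree: `∑_x w(x) · depth(x)`, the root having depth 1. -/
noncomputable def cost (w : V → ℝ) (T : RTree V) : ℝ :=
  ∑ᶠ v ∈ T.vertSet, w v * (T.depth v : ℝ)

/-- The optimum cost of a search tree on the subgraph of `G` induced by `s`. -/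
noncomputable def OPT (G : SimpleGraph V) (w : V → ℝ) (s : Set V) : ℝ :=
  sInf (cost w '' {T | IsSearchTree G s T})

/-- `v` is an `α`-centroid of the subgraph of `G` induced by `s` (with weights `w`):
every connected component of the induced subgraph on `s \ {v}` has weight at most
`α` times the weight of `s`. -/
def IsAlphaCentroid (G : SimpleGraph V) (w : V → ℝ) (α : ℝ) (s : Set V) (v : V) : Prop :=
  v ∈ s ∧ ∀ x ∈ s \ {v}, wsum w (compIn G (s \ {v}) x) ≤ α * wsum w s

/-- `v` is a centroid of the subgraph of `G` induced by `s` (with weights `w`). -/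
def IsCentroid (G : SimpleGraph V) (w : V → ℝ) (s : Set V) (v : V) : Prop :=
  v ∈ s ∧ ∀ x ∈ s \ {v}, wsum w (compIn G (s \ {v}) x) ≤ wsum w s / 2

/-- `T` is an `α`-centroid tree on the subgraph of `G` induced by `s`. -/
def IsAlphaCentroidTree (G : SimpleGraph V) (w : V → ℝ) (α : ℝ) (s : Set V) (T : RTree V) :
    Prop :=
  IsSearchTree G s T ∧ ∀ t ∈ T.allSubtrees, IsAlphaCentroid G w α t.vertSet t.root

/-- `T` is a centroid tree on the subgraph of `G` induced by `s`. -/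
def IsCentroidTree (G : SimpleGraph V) (w : V → ℝ) (s : Set V) (T : RTree V) : Prop :=
  IsSearchTree G s T ∧ ∀ t ∈ T.allSubtrees, IsCentroid G w t.vertSet t.root

/-- `cent(𝒯,w)`: the maximum cost of a centroid tree. -/
noncomputable def centCost (G : SimpleGraph V) (w : V → ℝ) (s : Set V) : ℝ :=
  sSup (cost w '' {T | IsCentroidTree G w s T})

/-- `centᵅ(𝒯,w)`: the maximum cost of an `α`-centroid tree (`0` if none exists, since
`sSup ∅ = 0` in `ℝ`). -/
noncomputable def centCostA (G : SimpleGraph V) (w : V → ℝ) (α : ℝ) (s : Set V) : ℝ :=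
  sSup (cost w '' {T | IsAlphaCentroidTree G w α s T})

/-- `b` is a child of `a` in the rooted tree `T`. -/
def ChildRel (T : RTree V) (a b : V) : Prop :=
  ∃ t ∈ T.allSubtrees, t.root = a ∧ ∃ t' ∈ t.children, t'.root = b

namespace RTree

theorem mem_pathsFrom_node {r : V} {ts : List (RTree V)} {p : V × List V} :
    p ∈ (node r ts).pathsFrom ↔
      p = (r, [r]) ∨ ∃ t ∈ ts, ∃ q ∈ t.pathsFrom, p = (q.1, r :: q.2) := by
  rw [pathsFrom]
  simp only [List.mem_cons, List.mem_flatten, List.mem_map, List.mem_attach, true_and,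
    Subtype.exists]
  constructor
  · rintro (h | ⟨l, ⟨t, ht, rfl⟩, hp⟩)
    · exact Or.inl h
    · obtain ⟨q, hq, rfl⟩ := List.mem_map.1 hp
      exact Or.inr ⟨t, ht, q, hq, rfl⟩
  · rintro (h | ⟨t, ht, q, hq, rfl⟩)
    · exact Or.inl h
    · exact Or.inr ⟨_, ⟨t, ht, rfl⟩, List.mem_map.2 ⟨q, hq, rfl⟩⟩

theorem mem_vertSet_node {r : V} {ts : List (RTree V)} {v : V} :
    v ∈ (node r ts).vertSet ↔ v = r ∨ ∃ t ∈ ts, v ∈ t.vertSet := by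
  simp only [vertSet, Set.mem_ofPred_eq, mem_pathsFrom_node]
  constructor
  · rintro ⟨p, rfl | ⟨t, ht, q, hq, rfl⟩, rfl⟩
    · exact Or.inl rfl
    · exact Or.inr ⟨t, ht, q, hq, rfl⟩
  · rintro (rfl | ⟨t, ht, q, hq, rfl⟩)
    · exact ⟨_, Or.inl rfl, rfl⟩
    · exact ⟨_, Or.inr ⟨t, ht, q, hq, rfl⟩, rfl⟩

theorem mem_pathSet_node {r : V} {ts : List (RTree V)} {v y : V} :
    y ∈ (node r ts).pathSet v ↔
      (v = r ∧ y = r) ∨ ∃ t ∈ ts, (v ∈ t.vertSet ∧ y = r) ∨ y ∈ t.pathSet v := by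
  simp only [vertSet, pathSet, Set.mem_ofPred_eq, mem_pathsFrom_node]
  constructor
  · rintro ⟨p, rfl | ⟨t, ht, q, hq, rfl⟩, rfl, hy⟩
    · exact Or.inl ⟨rfl, by simpa using hy⟩
    · refine Or.inr ⟨t, ht, ?_⟩
      rcases List.mem_cons.1 hy with rfl | hy
      · exact Or.inl ⟨⟨q, hq, rfl⟩, rfl⟩
      · exact Or.inr ⟨q, hq, rfl, hy⟩
  · rintro (⟨rfl, rfl⟩ | ⟨t, ht, ⟨⟨q, hq, rfl⟩, rfl⟩ | ⟨q, hq, rfl, hy⟩⟩)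
    · exact ⟨_, Or.inl rfl, rfl, by simp⟩
    · exact ⟨_, Or.inr ⟨t, ht, q, hq, rfl⟩, rfl, by simp⟩
    · exact ⟨_, Or.inr ⟨t, ht, q, hq, rfl⟩, rfl, List.mem_cons_of_mem _ hy⟩

theorem mem_vertSet_of_mem_pathSet {T : RTree V} {v y : V} (h : y ∈ T.pathSet v) :
    v ∈ T.vertSet := by
  obtain ⟨p, hp, rfl, -⟩ := h
  exact ⟨p, hp, rfl⟩

theorem root_mem_pathSet {r : V} {ts : List (RTree V)} {v : V}
    (hv : v ∈ (node r ts).vertSet) : r ∈ (node r ts).pathSet v := by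
  rw [mem_pathSet_node]
  rcases mem_vertSet_node.1 hv with h | ⟨t, ht, h⟩
  · exact Or.inl ⟨h, rfl⟩
  · exact Or.inr ⟨t, ht, Or.inl ⟨h, rfl⟩⟩

theorem mem_allSubtrees_node {r : V} {ts : List (RTree V)} {t : RTree V} :
    t ∈ (node r ts).allSubtrees ↔ t = node r ts ∨ ∃ u ∈ ts, t ∈ u.allSubtrees := by
  rw [allSubtrees]
  simp only [List.mem_cons, List.mem_flatten, List.mem_map, List.mem_attach, true_and,
    Subtype.exists]
  constructor
  · rintro (h | ⟨l, ⟨u, hu, rfl⟩, h⟩)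
    · exact Or.inl h
    · exact Or.inr ⟨u, hu, h⟩
  · rintro (h | ⟨u, hu, h⟩)
    · exact Or.inl h
    · exact Or.inr ⟨_, ⟨u, hu, rfl⟩, h⟩

end RTree

section Connectivity

variable {G : SimpleGraph V} {s : Set V} {x y z : V}

theorem ReachIn.refl (hx : x ∈ s) : ReachIn G s x x :=
  ⟨SimpleGraph.Walk.nil, by simpa using hx⟩

theorem ReachIn.symm (h : ReachIn G s x y) : ReachIn G s y x := by
  obtain ⟨p, hp⟩ := h
  exact ⟨p.reverse, by simpa using hp⟩

theorem ReachIn.trans (h : ReachIn G s x y) (h' : ReachIn G s y z) : ReachIn G s x z := by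
  obtain ⟨p, hp⟩ := h
  obtain ⟨q, hq⟩ := h'
  refine ⟨p.append q, fun v hv => ?_⟩
  rcases (SimpleGraph.Walk.mem_support_append_iff p q).1 hv with h | h
  exacts [hp v h, hq v h]

theorem ReachIn.mono {t : Set V} (hst : s ⊆ t) (h : ReachIn G s x y) : ReachIn G t x y := by
  obtain ⟨p, hp⟩ := h
  exact ⟨p, fun v hv => hst (hp v hv)⟩

theorem ReachIn.left_mem (h : ReachIn G s x y) : x ∈ s := by
  obtain ⟨p, hp⟩ := h
  exact hp _ p.start_mem_support

theorem ReachIn.right_mem (h : ReachIn G s x y) : y ∈ s := h.symm.left_mem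

theorem ReachIn.of_adj (h : G.Adj x y) (hx : x ∈ s) (hy : y ∈ s) : ReachIn G s x y := by
  refine ⟨h.toWalk, fun v hv => ?_⟩
  have : v = x ∨ v = y := by simpa using hv
  rcases this with rfl | rfl <;> assumption

theorem compIn_subset : compIn G s x ⊆ s := fun _ h => ReachIn.right_mem h

theorem mem_compIn_self (hx : x ∈ s) : x ∈ compIn G s x := ReachIn.refl hx

theorem compIn_eq_of_mem (h : y ∈ compIn G s x) : compIn G s y = compIn G s x :=
  Set.ext fun _ => ⟨fun h' => ReachIn.trans h h', fun h' => ReachIn.trans (ReachIn.symm h) h'⟩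

theorem mem_compIn_iff (hy : y ∈ s) : y ∈ compIn G s x ↔ compIn G s y = compIn G s x :=
  ⟨compIn_eq_of_mem, fun h => h ▸ mem_compIn_self hy⟩

theorem connIn_compIn (hx : x ∈ s) : ConnIn G (compIn G s x) := by
  classical
  have key : ∀ y ∈ compIn G s x, ReachIn G (compIn G s x) x y := by
    rintro y ⟨p, hp⟩
    refine ⟨p, fun v hv => ?_⟩
    exact ⟨p.takeUntil v hv, fun u hu => hp u (p.support_takeUntil_subset_support hv hu)⟩
  exact ⟨⟨x, mem_compIn_self hx⟩, fun y hy z hz => (key y hy).symm.trans (key z hz)⟩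

/-- Removing from a connected set one component of the complement of a vertex leaves a
connected set. -/
theorem ConnIn.diff_compIn {c : V} (hs : ConnIn G s) (hc : c ∈ s) (a : V) :
    ConnIn G (s \ compIn G (s \ {c}) a) := by
  set H := compIn G (s \ {c}) a with hH
  have hcH : c ∉ H := fun h => (compIn_subset h).2 rfl
  have aux : ∀ y z (p : G.Walk y z), z = c → (∀ v ∈ p.support, v ∈ s) → y ∉ H →
      ReachIn G (s \ H) y c := by
    intro y z p
    induction p with
    | nil => rintro rfl hp hy; exact ReachIn.refl ⟨hc, hy⟩
    | @cons u v z huv q ih =>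
      intro hz hp hy
      have hu : u ∈ s := hp u (by simp)
      have hv : v ∈ s := hp v (by simp)
      by_cases huc : u = c
      · subst huc; exact ReachIn.refl ⟨hu, hy⟩
      by_cases hvH : v ∈ H
      · exact absurd (ReachIn.trans hvH
          (ReachIn.of_adj huv.symm (compIn_subset hvH) (show u ∈ s \ {c} from ⟨hu, huc⟩))) hy
      · exact (ReachIn.of_adj (s := s \ H) huv ⟨hu, hy⟩ ⟨hv, hvH⟩).trans
          (ih hz (fun w hw => hp w (by simp [hw])) hvH)
  have key : ∀ y ∈ s \ H, ReachIn G (s \ H) y c := by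
    rintro y ⟨hy, hyH⟩
    obtain ⟨p, hp⟩ := hs.2 y hy c hc
    exact aux y c p rfl hp hyH
  exact ⟨⟨c, ⟨hc, hcH⟩⟩, fun y hy z hz => (key y hy).trans (key z hz).symm⟩

theorem SimpleGraph.Connected.connIn_univ (hG : G.Connected) : ConnIn G Set.univ := by
  obtain ⟨x⟩ := hG.nonempty
  refine ⟨⟨x, trivial⟩, fun y _ z _ => ?_⟩
  obtain ⟨p⟩ := hG.preconnected y z
  exact ⟨p, fun _ _ => trivial⟩

end Connectivity

section SearchTree

variable {G : SimpleGraph V} {s : Set V}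

theorem IsSearchTree.vertSet_eq {T : RTree V} (h : IsSearchTree G s T) : T.vertSet = s := by
  cases h; assumption

theorem IsSearchTree.root_mem {T : RTree V} (h : IsSearchTree G s T) : T.root ∈ s := by
  cases h; assumption

/-- The lowest common ancestor of a connected set of vertices belongs to that set. -/
theorem IsSearchTree.exists_common_ancestor {T : RTree V} (h : IsSearchTree G s T) {A : Set V}
    (hA : ConnIn G A) (hAs : A ⊆ s) : ∃ r ∈ A, ∀ x ∈ A, r ∈ T.pathSet x := by
  induction h with
  | @node s r ts hr hv hch hpw ih =>
    by_cases hrA : r ∈ A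
    · exact ⟨r, hrA, fun x hx => RTree.root_mem_pathSet (hv ▸ hAs hx)⟩
    have hA' : A ⊆ s \ {r} := fun x hx => ⟨hAs hx, fun h => hrA (h ▸ hx)⟩
    obtain ⟨y, hy⟩ := hA.1
    have hy' : y ∈ (RTree.node r ts).vertSet := hv ▸ hAs hy
    rcases RTree.mem_vertSet_node.1 hy' with rfl | ⟨t, ht, hyt⟩
    · exact absurd hy hrA
    rw [(hch t ht).vertSet_eq] at hyt
    obtain ⟨z, hz, hz'⟩ := ih t ht
      (fun x hx => ReachIn.trans hyt ((hA.2 y hy x hx).mono hA'))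
    exact ⟨z, hz, fun x hx => RTree.mem_pathSet_node.2 (Or.inr ⟨t, ht, Or.inr (hz' x hx)⟩)⟩

theorem IsSearchTree.mem_pathSet_self {T : RTree V} (h : IsSearchTree G s T) {x : V}
    (hx : x ∈ s) : x ∈ T.pathSet x := by
  have hA : ConnIn G {x} := ⟨⟨x, rfl⟩, by rintro _ rfl _ rfl; exact ReachIn.refl rfl⟩
  obtain ⟨r, rfl, hr⟩ := h.exists_common_ancestor hA (by simpa using hx)
  exact hr r rfl

theorem IsSearchTree.one_le_depth [Finite V] {T : RTree V} (h : IsSearchTree G s T) {x : V}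
    (hx : x ∈ s) : 1 ≤ T.depth x :=
  (Set.ncard_pos (Set.toFinite _)).2 ⟨x, h.mem_pathSet_self hx⟩

theorem exists_isSearchTree [Finite V] (hs : ConnIn G s) : ∃ T, IsSearchTree G s T := by
  classical
  induction hn : s.ncard using Nat.strong_induction_on generalizing s with
  | _ n ih =>
    obtain ⟨r, hr⟩ := hs.1
    have hlt : ∀ x, (compIn G (s \ {r}) x).ncard < n := fun x => hn ▸
      Set.ncard_lt_ncard ⟨compIn_subset.trans Set.sdiff_subset,
        fun h => (compIn_subset (h hr)).2 rfl⟩ (Set.toFinite _)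
    have hex : ∀ H ∈ comps G (s \ {r}), ∃ T, IsSearchTree G H T := by
      rintro _ ⟨x, hx, rfl⟩
      exact ih _ (hlt x) (connIn_compIn hx) rfl
    have : Nonempty (RTree V) := ⟨.node r []⟩
    choose! f hf using hex
    have hroot : ∀ H ∈ comps G (s \ {r}), compIn G (s \ {r}) (f H).root = H := by
      intro H hH
      have h1 := (hf H hH).root_mem
      obtain ⟨x, hx, rfl⟩ := hH
      exact compIn_eq_of_mem h1
    have hfin : (comps G (s \ {r})).Finite := Set.toFinite _
    have hmem : ∀ H, H ∈ hfin.toFinset.toList ↔ H ∈ comps G (s \ {r}) := by simp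
    refine ⟨.node r (hfin.toFinset.toList.map f), .node hr ?_ ?_ ?_⟩
    · ext v
      simp only [RTree.mem_vertSet_node, List.mem_map, hmem]
      constructor
      · rintro (rfl | ⟨_, ⟨H, hH, rfl⟩, hv⟩)
        · exact hr
        · rw [(hf H hH).vertSet_eq] at hv
          obtain ⟨x, hx, rfl⟩ := hH
          exact (compIn_subset hv).1
      · intro hv
        by_cases hvr : v = r
        · exact Or.inl hvr
        have hH : compIn G (s \ {r}) v ∈ comps G (s \ {r}) := ⟨v, ⟨hv, hvr⟩, rfl⟩
        refine Or.inr ⟨_, ⟨_, hH, rfl⟩, ?_⟩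
        rw [(hf _ hH).vertSet_eq]
        exact mem_compIn_self ⟨hv, hvr⟩
    · intro t ht
      obtain ⟨H, hH, rfl⟩ := List.mem_map.1 ht
      rw [hmem] at hH
      rw [hroot H hH]
      exact hf H hH
    · rw [List.pairwise_map]
      refine (Finset.nodup_toList _).imp_of_mem fun {A B} hA hB hAB => ?_
      rw [hroot A ((hmem A).1 hA), hroot B ((hmem B).1 hB)]
      exact hAB

/-- Passing from a child subtree to the whole search tree increases depths by at most one. -/
theorem IsSearchTree.depth_node_le [Finite V] {c : V} {ts : List (RTree V)}
    (h : IsSearchTree G s (.node c ts)) {t : RTree V} (ht : t ∈ ts) {x : V}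
    (hx : x ∈ t.vertSet) : (RTree.node c ts).depth x ≤ t.depth x + 1 := by
  cases h with
  | node hc hv hch hpw =>
    refine (Set.ncard_le_ncard (t := insert c (t.pathSet x)) ?_ (Set.toFinite _)).trans
      (Set.ncard_insert_le _ _)
    intro y hy
    rcases RTree.mem_pathSet_node.1 hy with ⟨-, rfl⟩ | ⟨u, hu, ⟨-, rfl⟩ | hyu⟩
    · exact Or.inl rfl
    · exact Or.inl rfl
    · right
      have hxu := RTree.mem_vertSet_of_mem_pathSet hyu
      rw [(hch u hu).vertSet_eq] at hxu
      rw [(hch t ht).vertSet_eq] at hx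
      by_contra hne
      have htu : t ≠ u := fun h => hne (h ▸ hyu)
      have hsymm : Std.Symm (fun t₁ t₂ : RTree V =>
          compIn G (s \ {c}) t₁.root ≠ compIn G (s \ {c}) t₂.root) := ⟨fun _ _ h => h.symm⟩
      exact hpw.forall ht hu htu ((compIn_eq_of_mem hx).symm.trans (compIn_eq_of_mem hxu))

theorem IsSearchTree.depth_root_le {c : V} {ts : List (RTree V)}
    (h : IsSearchTree G s (.node c ts)) : (RTree.node c ts).depth c ≤ 1 := by
  cases h with
  | node hc hv hch hpw =>
    have hsub : (RTree.node c ts).pathSet c ⊆ {c} := by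
      intro y hy
      rcases RTree.mem_pathSet_node.1 hy with ⟨-, rfl⟩ | ⟨u, hu, ⟨-, rfl⟩ | hyu⟩
      · rfl
      · rfl
      · have hcu := RTree.mem_vertSet_of_mem_pathSet hyu
        rw [(hch u hu).vertSet_eq] at hcu
        exact absurd rfl (compIn_subset hcu).2
    exact (Set.ncard_le_ncard hsub).trans (Set.ncard_singleton c).le

end SearchTree

section Weights

variable [Fintype V]

open Classical in
theorem wsum_eq_sum_ite (w : V → ℝ) (s : Set V) : wsum w s = ∑ x, if x ∈ s then w x else 0 := by
  rw [wsum, finsum_mem_def, finsum_eq_sum_of_fintype]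
  simp [Set.indicator_apply]

theorem wsum_nonneg {w : V → ℝ} (hw : ∀ x, 0 ≤ w x) (s : Set V) : 0 ≤ wsum w s := by
  classical
  rw [wsum_eq_sum_ite]
  refine Finset.sum_nonneg fun x _ => ?_
  split_ifs
  exacts [hw x, le_rfl]

theorem wsum_mono_fun {f g : V → ℝ} {s : Set V} (h : ∀ x ∈ s, f x ≤ g x) :
    wsum f s ≤ wsum g s := by
  rw [wsum_eq_sum_ite, wsum_eq_sum_ite]
  refine Finset.sum_le_sum fun x _ => ?_
  split_ifs with hx
  exacts [h x hx, le_rfl]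

theorem IsSearchTree.wsum_le_cost {G : SimpleGraph V} {s : Set V} {w : V → ℝ}
    (hw : ∀ x, 0 ≤ w x) {T : RTree V} (h : IsSearchTree G s T) : wsum w s ≤ cost w T := by
  have h1 : cost w T = wsum (fun x => w x * (T.depth x : ℝ)) s := by
    rw [← h.vertSet_eq]; rfl
  rw [h1]
  refine wsum_mono_fun fun x hx => le_mul_of_one_le_right (hw x) ?_
  exact_mod_cast h.one_le_depth hx

/-- A sum over `s` splits into the term at `c` and the sums over the components of `s \ {c}`. -/
theorem wsum_eq_add_sum_comps (G : SimpleGraph V) (f : V → ℝ) {s : Set V} {c : V} (hc : c ∈ s) :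
    wsum f s = f c + ∑ H ∈ (Set.toFinite (comps G (s \ {c}))).toFinset, wsum f H := by
  classical
  have h1 : wsum f s = f c + ∑ x ∈ Finset.univ.filter (· ∈ s \ {c}), f x := by
    rw [wsum_eq_sum_ite, ← Finset.sum_filter,
      ← Finset.add_sum_erase _ _ (Finset.mem_filter.2 ⟨Finset.mem_univ c, hc⟩)]
    congr 2
    ext x
    simp [and_comm]
  rw [h1, ← Finset.sum_fiberwise_of_maps_to (g := compIn G (s \ {c}))
    (t := (Set.toFinite (comps G (s \ {c}))).toFinset)]
  · congr 1
    refine Finset.sum_congr rfl fun H hH => ?_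
    rw [wsum_eq_sum_ite, ← Finset.sum_filter]
    congr 1
    ext x
    obtain ⟨y, hy, rfl⟩ := (Set.Finite.mem_toFinset _).1 hH
    simp only [Finset.mem_filter, Finset.mem_univ, true_and]
    constructor
    · rintro ⟨hx, hxy⟩
      exact (mem_compIn_iff hx).2 hxy
    · exact fun hx => ⟨compIn_subset hx, compIn_eq_of_mem hx⟩
  · intro x hx
    rw [Set.Finite.mem_toFinset]
    exact ⟨x, (Finset.mem_filter.1 hx).2, rfl⟩

/-- The decrease of the restricted cost of a search tree caused by splitting at an
`α`-centroid `c`. The search tree enters only through its root paths `P`. -/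
theorem restricted_cost_gain {G : SimpleGraph V} {w : V → ℝ} (hw : ∀ x, 0 ≤ w x) {α : ℝ}
    (hα : 1 / 3 ≤ α) (hα' : α ≤ 1 / 2) {P : V → Set V}
    (hP : ∀ A, ConnIn G A → ∃ r ∈ A, ∀ x ∈ A, r ∈ P x) (hPself : ∀ x, x ∈ P x)
    {s : Set V} (hs : ConnIn G s) {c : V} (hc : IsAlphaCentroid G w α s c) :
    (2 - 3 * α) * wsum w s + (3 * α - 1) * w c +
        wsum (fun x => w x * ((P x ∩ compIn G (s \ {c}) x).ncard : ℝ)) s ≤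
      wsum (fun x => w x * ((P x ∩ s).ncard : ℝ)) s := by
  classical
  obtain ⟨hcs, hcent⟩ := hc
  have hwc : wsum (fun x => if x = c then w x else 0) s = w c := by
    rw [wsum_eq_sum_ite, Finset.sum_eq_single c] <;> simp +contextual [hcs]
  have hwcs : w c ≤ wsum w s := by
    rw [← hwc]
    refine wsum_mono_fun fun x _ => ?_
    split_ifs
    exacts [le_rfl, hw x]
  have hcomp : ∀ a, wsum (fun x => if x ∈ compIn G (s \ {c}) a then w x else 0) s =
      wsum w (compIn G (s \ {c}) a) := by
    intro a
    rw [wsum_eq_sum_ite, wsum_eq_sum_ite]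
    refine Finset.sum_congr rfl fun x _ => ?_
    by_cases hx : x ∈ compIn G (s \ {c}) a
    · simp [hx, (compIn_subset hx).1]
    · simp [hx]
  have hlin : ∀ (k p q l : ℝ) (a b : V),
      wsum (fun x => k * w x - p * (if x ∈ compIn G (s \ {c}) a then w x else 0)
        - q * (if x ∈ compIn G (s \ {c}) b then w x else 0)
        + l * (if x = c then w x else 0)) s =
      k * wsum w s - p * wsum w (compIn G (s \ {c}) a)
        - q * wsum w (compIn G (s \ {c}) b) + l * w c := by
    intro k p q l a b
    rw [← hcomp a, ← hcomp b]
    conv_rhs => rw [← hwc]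
    simp only [wsum_eq_sum_ite, Finset.mul_sum, ← Finset.sum_sub_distrib, ← Finset.sum_add_distrib]
    refine Finset.sum_congr rfl fun x _ => ?_
    split_ifs <;> ring
  have hgain : ∀ (k p q l : ℝ) (a b : V),
      (∀ x ∈ s, ((P x ∩ compIn G (s \ {c}) x).ncard : ℝ) + (k
        - p * (if x ∈ compIn G (s \ {c}) a then 1 else 0)
        - q * (if x ∈ compIn G (s \ {c}) b then 1 else 0)
        + l * (if x = c then 1 else 0)) ≤ (P x ∩ s).ncard) →
      k * wsum w s - p * wsum w (compIn G (s \ {c}) a)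
        - q * wsum w (compIn G (s \ {c}) b) + l * w c +
        wsum (fun x => w x * ((P x ∩ compIn G (s \ {c}) x).ncard : ℝ)) s ≤
      wsum (fun x => w x * ((P x ∩ s).ncard : ℝ)) s := by
    intro k p q l a b h
    rw [← hlin]
    have hadd : ∀ f g : V → ℝ, wsum f s + wsum g s = wsum (fun x => f x + g x) s := by
      intro f g
      simp only [wsum_eq_sum_ite, ← Finset.sum_add_distrib]
      refine Finset.sum_congr rfl fun x _ => ?_
      split_ifs <;> simp
    rw [hadd]
    refine wsum_mono_fun fun x hx => ?_
    refine le_trans (le_of_eq ?_) (mul_le_mul_of_nonneg_left (h x hx) (hw x))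
    split_ifs <;> ring
  have hmono : ∀ x, compIn G (s \ {c}) x ⊆ s := fun x => compIn_subset.trans Set.sdiff_subset
  have hcard : ∀ (x : V) (B : Finset V),
      (∀ b ∈ B, b ∈ P x ∧ b ∈ s ∧ b ∉ compIn G (s \ {c}) x) →
      (P x ∩ compIn G (s \ {c}) x).ncard + B.card ≤ (P x ∩ s).ncard := by
    intro x B hB
    rw [← Set.ncard_coe_finset, ← Set.ncard_union_eq ?_ (Set.toFinite _) (Set.toFinite _)]
    · refine Set.ncard_le_ncard ?_ (Set.toFinite _)
      rintro y (hy | hy)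
      · exact ⟨hy.1, hmono x hy.2⟩
      · exact ⟨(hB y hy).1, (hB y hy).2.1⟩
    · exact Set.disjoint_left.2 fun y hy hyB => (hB y hyB).2.2 hy.2
  have hcnot : ∀ x, c ∉ compIn G (s \ {c}) x := fun x h => (compIn_subset h).2 rfl
  obtain ⟨r, hrs, hr⟩ := hP s hs
  by_cases hrc : r = c
  · subst hrc
    have h := hgain 1 0 0 0 r r fun x hx => by
      have := hcard x {r} (by simpa using ⟨hr x hx, hrs, hcnot x⟩)
      simp only [Finset.card_singleton] at this
      have : ((P x ∩ compIn G (s \ {r}) x).ncard : ℝ) + 1 ≤ (P x ∩ s).ncard := by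
        exact_mod_cast this
      linarith
    nlinarith
  set H := compIn G (s \ {c}) r with hH
  have hrH : r ∈ H := mem_compIn_self ⟨hrs, hrc⟩
  have hnotr : ∀ x, x ∉ H → r ∉ compIn G (s \ {c}) x := fun x hx h => hx (ReachIn.symm h)
  have hHw : wsum w H ≤ α * wsum w s := hcent r ⟨hrs, hrc⟩
  obtain ⟨r', hr's, hr'⟩ := hP _ (hs.diff_compIn hcs r)
  rw [← hH] at hr's hr'
  have hrr' : r ≠ r' := fun h => hr's.2 (h ▸ hrH)
  by_cases hrc' : r' = c
  · subst hrc'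
    have h := hgain 2 2 0 0 r r fun x hx => by
      by_cases hxH : x ∈ H
      · have := hcard x ∅ (by simp)
        simp only [Finset.card_empty] at this
        have : ((P x ∩ compIn G (s \ {r'}) x).ncard : ℝ) ≤ (P x ∩ s).ncard := by
          exact_mod_cast this
        rw [← hH, if_pos hxH]
        linarith
      · have := hcard x {r, r'} (by
          simpa using ⟨⟨hr x hx, hrs, hnotr x hxH⟩, hr' x ⟨hx, hxH⟩, hcs, hcnot x⟩)
        rw [Finset.card_pair hrr'] at this
        have : ((P x ∩ compIn G (s \ {r'}) x).ncard : ℝ) + 2 ≤ (P x ∩ s).ncard := by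
          exact_mod_cast this
        rw [← hH, if_neg hxH]
        linarith
    rw [← hH] at h
    nlinarith [mul_nonneg (show (0 : ℝ) ≤ 3 * α - 1 by linarith) (sub_nonneg.2 hwcs),
      mul_nonneg (show (0 : ℝ) ≤ 1 - 2 * α by linarith) (wsum_nonneg hw s)]
  · set H' := compIn G (s \ {c}) r' with hH'
    have hnotr' : ∀ x, x ∉ H' → r' ∉ compIn G (s \ {c}) x := fun x hx h => hx (ReachIn.symm h)
    have hHw' : wsum w H' ≤ α * wsum w s := hcent r' ⟨hr's.1, hrc'⟩
    have h := hgain 2 2 1 1 r r' fun x hx => by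
      rw [← hH, ← hH']
      by_cases hxH : x ∈ H
      · have hxH' : x ∉ H' := fun h => hr's.2 (ReachIn.trans hxH (ReachIn.symm h))
        have hxc : x ≠ c := fun h => hcnot r (by rwa [h, hH] at hxH)
        have := hcard x ∅ (by simp)
        simp only [Finset.card_empty] at this
        have : ((P x ∩ compIn G (s \ {c}) x).ncard : ℝ) ≤ (P x ∩ s).ncard := by
          exact_mod_cast this
        rw [if_pos hxH, if_neg hxH', if_neg hxc]
        linarith
      by_cases hxH' : x ∈ H'
      · have hxc : x ≠ c := fun h => hcnot r' (by rwa [h, hH'] at hxH')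
        have := hcard x {r} (by simpa using ⟨hr x hx, hrs, hnotr x hxH⟩)
        simp only [Finset.card_singleton] at this
        have : ((P x ∩ compIn G (s \ {c}) x).ncard : ℝ) + 1 ≤ (P x ∩ s).ncard := by
          exact_mod_cast this
        rw [if_neg hxH, if_pos hxH', if_neg hxc]
        linarith
      by_cases hxc : x = c
      · have := hcard x {c, r, r'} (by
          simpa using ⟨⟨hxc ▸ hPself x, hcs, hcnot x⟩, ⟨hr x hx, hrs, hnotr x hxH⟩,
            hr' x ⟨hx, hxH⟩, hr's.1, hnotr' x hxH'⟩)
        rw [Finset.card_eq_three.2 ⟨c, r, r', Ne.symm hrc, Ne.symm hrc', hrr', rfl⟩] at this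
        have : ((P x ∩ compIn G (s \ {c}) x).ncard : ℝ) + 3 ≤ (P x ∩ s).ncard := by
          exact_mod_cast this
        rw [if_neg hxH, if_neg hxH', if_pos hxc]
        linarith
      · have := hcard x {r, r'} (by
          simpa using ⟨⟨hr x hx, hrs, hnotr x hxH⟩, hr' x ⟨hx, hxH⟩, hr's.1, hnotr' x hxH'⟩)
        rw [Finset.card_pair hrr'] at this
        have : ((P x ∩ compIn G (s \ {c}) x).ncard : ℝ) + 2 ≤ (P x ∩ s).ncard := by
          exact_mod_cast this
        rw [if_neg hxH, if_neg hxH', if_neg hxc]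
        linarith
    rw [← hH, ← hH'] at h
    nlinarith [hw c]

theorem IsSearchTree.cost_le_restricted_cost {G : SimpleGraph V} {w : V → ℝ} (hw : ∀ x, 0 ≤ w x)
    {α : ℝ} (hα : 1 / 3 ≤ α) (hα' : α ≤ 1 / 2) {P : V → Set V}
    (hP : ∀ A, ConnIn G A → ∃ r ∈ A, ∀ x ∈ A, r ∈ P x) (hPself : ∀ x, x ∈ P x)
    {s : Set V} {C : RTree V} (hC : IsSearchTree G s C)
    (hcent : ∀ t ∈ C.allSubtrees, IsAlphaCentroid G w α t.vertSet t.root) (hs : ConnIn G s) :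
    (2 - 3 * α) * cost w C + (3 * α - 1) * wsum w s ≤
      wsum (fun x => w x * ((P x ∩ s).ncard : ℝ)) s := by
  induction hC with
  | @node s c ts hc hv hch hpw ih =>
    have hnode : IsSearchTree G s (.node c ts) := .node hc hv hch hpw
    have hcc : IsAlphaCentroid G w α s c := by
      have := hcent _ (RTree.mem_allSubtrees_node.2 (Or.inl rfl))
      rwa [hv] at this
    have hgain := restricted_cost_gain hw hα hα' hP hPself hs hcc
    have hcost : cost w (.node c ts) =
        wsum (fun x => w x * ((RTree.node c ts).depth x : ℝ)) s := by
      conv_rhs => rw [← hv]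
      rfl
    have hcomp : ∀ H ∈ (Set.toFinite (comps G (s \ {c}))).toFinset,
        (2 - 3 * α) * wsum (fun x => w x * ((RTree.node c ts).depth x : ℝ)) H ≤
          wsum (fun x => w x * ((P x ∩ compIn G (s \ {c}) x).ncard : ℝ)) H +
            (3 - 6 * α) * wsum w H := by
      intro H hH
      obtain ⟨y, hy, rfl⟩ := (Set.Finite.mem_toFinset _).1 hH
      have hyv : y ∈ (RTree.node c ts).vertSet := hv ▸ hy.1
      rcases RTree.mem_vertSet_node.1 hyv with hyc | ⟨t, ht, hyt⟩
      · exact absurd hyc hy.2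
      have hvt := (hch t ht).vertSet_eq
      rw [hvt] at hyt
      have hroot := compIn_eq_of_mem hyt
      have hIH := ih t ht
        (fun u hu => hcent u (RTree.mem_allSubtrees_node.2 (Or.inr ⟨t, ht, hu⟩)))
        (hroot ▸ connIn_compIn hy)
      rw [← hroot] at hIH hvt
      have h1 : wsum (fun x => w x * ((RTree.node c ts).depth x : ℝ)) (compIn G (s \ {c}) y) ≤
          cost w t + wsum w (compIn G (s \ {c}) y) := by
        have : cost w t = wsum (fun x => w x * (t.depth x : ℝ)) (compIn G (s \ {c}) y) := by
          rw [← hvt]; rfl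
        rw [this, wsum_eq_sum_ite, wsum_eq_sum_ite, wsum_eq_sum_ite, ← Finset.sum_add_distrib]
        refine Finset.sum_le_sum fun x _ => ?_
        split_ifs with hx
        · have hd : ((RTree.node c ts).depth x : ℝ) ≤ t.depth x + 1 := by
            exact_mod_cast hnode.depth_node_le ht (hvt ▸ hx)
          nlinarith [hw x]
        · simp
      have h2 : wsum (fun x => w x * ((P x ∩ compIn G (s \ {c}) y).ncard : ℝ))
          (compIn G (s \ {c}) y) ≤
          wsum (fun x => w x * ((P x ∩ compIn G (s \ {c}) x).ncard : ℝ))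
          (compIn G (s \ {c}) y) :=
        wsum_mono_fun fun x hx => by rw [compIn_eq_of_mem hx]
      nlinarith
    have hsum := Finset.sum_le_sum hcomp
    rw [← Finset.mul_sum, Finset.sum_add_distrib, ← Finset.mul_sum] at hsum
    have e1 := wsum_eq_add_sum_comps G (fun x => w x * ((RTree.node c ts).depth x : ℝ)) hc
    have e2 := wsum_eq_add_sum_comps G w hc
    have e3 := wsum_eq_add_sum_comps G
      (fun x => w x * ((P x ∩ compIn G (s \ {c}) x).ncard : ℝ)) hc
    have hd : ((RTree.node c ts).depth c : ℝ) ≤ 1 := by exact_mod_cast hnode.depth_root_le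
    have hd' : w c * ((RTree.node c ts).depth c : ℝ) ≤ w c := mul_le_of_le_one_right (hw c) hd
    have hn : 0 ≤ w c * ((P c ∩ compIn G (s \ {c}) c).ncard : ℝ) :=
      mul_nonneg (hw c) (Nat.cast_nonneg _)
    rw [hcost]
    have hmul := mul_le_mul_of_nonneg_left hd' (show (0 : ℝ) ≤ 2 - 3 * α by linarith)
    rw [e1, mul_add]
    nlinarith

theorem IsAlphaCentroidTree.cost_le {G : SimpleGraph V} (hG : G.Connected) {w : V → ℝ}
    (hw : ∀ x, 0 ≤ w x) {α : ℝ} (hα : 1 / 3 ≤ α) (hα' : α ≤ 1 / 2) {C T : RTree V}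
    (hC : IsAlphaCentroidTree G w α Set.univ C) (hT : IsSearchTree G Set.univ T) :
    (2 - 3 * α) * cost w C + (3 * α - 1) * wsum w Set.univ ≤ cost w T := by
  have h := hC.1.cost_le_restricted_cost hw hα hα' (P := T.pathSet)
    (fun A hA => hT.exists_common_ancestor hA (Set.subset_univ A))
    (fun x => hT.mem_pathSet_self trivial) hC.2 hG.connIn_univ
  have hcost : cost w T = wsum (fun x => w x * (T.depth x : ℝ)) Set.univ := by
    rw [← hT.vertSet_eq]; rfl
  simp only [Set.inter_univ] at h
  rw [hcost]
  exact h

end Weights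

theorem alpha_centroid_tree_approx_strong {V : Type} [Fintype V]
    (G : SimpleGraph V) (hG : G.IsTree) (w : V → ℝ) (hw : ∀ x, 0 ≤ w x) :
    (∀ α : ℝ, 1 / 3 ≤ α → α ≤ 1 / 2 →
      centCostA G w α Set.univ ≤
        (1 / (2 - 3 * α)) * OPT G w Set.univ -
          ((3 * α - 1) / (2 - 3 * α)) * wsum w Set.univ) ∧
    (∀ α : ℝ, 0 ≤ α → α ≤ 1 / 3 → ∀ T : RTree V,
      IsAlphaCentroidTree G w α Set.univ T → cost w T = OPT G w Set.univ) := by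
  have hconn := hG.connected
  have hne : (cost w '' {T | IsSearchTree G Set.univ T}).Nonempty := by
    obtain ⟨T, hT⟩ := exists_isSearchTree hconn.connIn_univ
    exact ⟨_, T, hT, rfl⟩
  have hm : wsum w Set.univ ≤ OPT G w Set.univ := by
    refine le_csInf hne ?_
    rintro _ ⟨T, hT, rfl⟩
    exact IsSearchTree.wsum_le_cost hw hT
  have hbound : ∀ α : ℝ, 1 / 3 ≤ α → α ≤ 1 / 2 → ∀ C, IsAlphaCentroidTree G w α Set.univ C →
      (2 - 3 * α) * cost w C + (3 * α - 1) * wsum w Set.univ ≤ OPT G w Set.univ := by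
    intro α hα hα' C hC
    refine le_csInf hne ?_
    rintro _ ⟨T, hT, rfl⟩
    exact hC.cost_le hconn hw hα hα' hT
  have hm0 : 0 ≤ wsum w Set.univ := wsum_nonneg hw _
  refine ⟨fun α hα hα' => ?_, fun α _ hα T hT => ?_⟩
  · have hpos : 0 < 2 - 3 * α := by linarith
    have hrw : (1 / (2 - 3 * α)) * OPT G w Set.univ -
        ((3 * α - 1) / (2 - 3 * α)) * wsum w Set.univ =
        (OPT G w Set.univ - (3 * α - 1) * wsum w Set.univ) / (2 - 3 * α) := by
      field_simp
    rw [hrw]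
    refine Real.sSup_le ?_ (div_nonneg (by nlinarith) hpos.le)
    rintro _ ⟨C, hC, rfl⟩
    rw [le_div_iff₀ hpos]
    linarith [hbound α hα hα' C hC]
  · refine le_antisymm ?_ (csInf_le ⟨wsum w Set.univ, ?_⟩ ⟨T, hT.1, rfl⟩)
    · have hT' : IsAlphaCentroidTree G w (1 / 3) Set.univ T :=
        ⟨hT.1, fun t ht => ⟨(hT.2 t ht).1, fun x hx => ((hT.2 t ht).2 x hx).trans
          (mul_le_mul_of_nonneg_right hα (wsum_nonneg hw _))⟩⟩
      linarith [hbound (1 / 3) le_rfl (by norm_num) T hT']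
    · rintro _ ⟨T', hT', rfl⟩
      exact IsSearchTree.wsum_le_cost hw hT'
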